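/- arXiv:1805.00304 — 2 statements merged into one kernel-verified Lean document; each statement's English description precedes it below -/
import Mathlib

section
/- Let K be a field, σ a finite type of indeterminates, and fix an admissible monomial order ≼ on σ →₀ ℕ. For every set F ⊆ MvPolynomial σ K, the reduction relation →_F is terminating: there is no infinite sequence p₀ →_F p₁ →_F p₂ →_F ⋯ of one-step reductions (equivalently, the converse relation of →_F is well-founded). -/
open MvPolynomial Relation

/-- An admissible monomial order on `σ →₀ ℕ`: a linear order such that `0` is the
smallest element and which is compatible with addition. -/
structure AdmissibleOrder (σ : Type*) where
  le : (σ →₀ ℕ) → (σ →₀ ℕ) → Prop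
  total : ∀ s t, le s t ∨ le t s
  refl : ∀ t, le t t
  trans : ∀ s t u, le s t → le t u → le s u
  antisymm : ∀ s t, le s t → le t s → s = t
  zero_le : ∀ t, le 0 t
  add_right : ∀ s t u, le s t → le (s + u) (t + u)

namespace AdmissibleOrder

variable {σ : Type*} {K : Type*} [Field K]

/-- The strict part of an admissible order. -/
def lt (m : AdmissibleOrder σ) (s t : σ →₀ ℕ) : Prop := m.le s t ∧ s ≠ t

-- The leading monomial of a polynomial: the `m.le`-largest element of its support
-- (`0` for the zero polynomial).
open Classical in
noncomputable def lm (m : AdmissibleOrder σ) (p : MvPolynomial σ K) : σ →₀ ℕ :=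
  if h : ∃ v, v ∈ p.support ∧ ∀ u ∈ p.support, m.le u v then h.choose else 0

/-- The leading coefficient of a polynomial. -/
noncomputable def lc (m : AdmissibleOrder σ) (p : MvPolynomial σ K) : K :=
  coeff (m.lm p) p

/-- One-step polynomial reduction modulo a set `F`. -/
def Red (m : AdmissibleOrder σ) (F : Set (MvPolynomial σ K))
    (p q : MvPolynomial σ K) : Prop :=
  ∃ f ∈ F, f ≠ 0 ∧ ∃ t : σ →₀ ℕ,
    coeff (t + m.lm f) p ≠ 0 ∧
    q = p - (coeff (t + m.lm f) p / m.lc f) • (monomial t (1 : K)) * f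

/-- A set `G` is a Gröbner basis iff the reduction relation modulo `G` is confluent. -/
def IsGroebner (m : AdmissibleOrder σ) (G : Set (MvPolynomial σ K)) : Prop :=
  ∀ a b c : MvPolynomial σ K, ReflTransGen (m.Red G) a b → ReflTransGen (m.Red G) a c →
    ∃ d, ReflTransGen (m.Red G) b d ∧ ReflTransGen (m.Red G) c d

-- The S-polynomial of two polynomials.
open Classical in
noncomputable def spoly (m : AdmissibleOrder σ) (p q : MvPolynomial σ K) :
    MvPolynomial σ K :=
  if p = 0 ∨ q = 0 then 0 else
    (monomial (m.lm p ⊔ m.lm q - m.lm p) (1 / m.lc p)) * p -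
    (monomial (m.lm p ⊔ m.lm q - m.lm q) (1 / m.lc q)) * q

end AdmissibleOrder

namespace AdmissibleOrder

variable {σ K : Type*} [Field K]

/-- An admissible order on monomials in finitely many indeterminates is a well-order,
by Dickson's lemma. -/
theorem wellFounded_lt [Finite σ] (m : AdmissibleOrder σ) : WellFounded m.lt := by
  have : IsPreorder (σ →₀ ℕ) m.le := { refl := m.refl, trans := m.trans }
  have hle : ∀ s t : σ →₀ ℕ, s ≤ t → m.le s t := fun s t h => by
    simpa [tsub_add_cancel_of_le h] using m.add_right 0 (t - s) s (m.zero_le _)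
  have hwqo : WellQuasiOrdered m.le := fun f =>
    let ⟨i, j, hij, h⟩ := wellQuasiOrdered_le f
    ⟨i, j, hij, hle _ _ h⟩
  exact hwqo.wellFounded.mono fun s t h => ⟨h.1, fun h' => h.2 (m.antisymm _ _ h.1 h')⟩

theorem exists_le_of_nonempty (m : AdmissibleOrder σ) {s : Finset (σ →₀ ℕ)}
    (hs : s.Nonempty) : ∃ v ∈ s, ∀ u ∈ s, m.le u v := by
  induction hs using Finset.Nonempty.cons_induction with
  | singleton a => exact ⟨a, by simp, by simpa using m.refl a⟩
  | cons a s ha hs ih =>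
    obtain ⟨v, hv, hmax⟩ := ih
    rcases m.total a v with h | h
    · exact ⟨v, by simp [hv], by simpa using ⟨h, hmax⟩⟩
    · exact ⟨a, by simp, by simpa using ⟨m.refl a, fun u hu => m.trans _ _ _ (hmax u hu) h⟩⟩

theorem lm_spec (m : AdmissibleOrder σ) {p : MvPolynomial σ K} (hp : p ≠ 0) :
    m.lm p ∈ p.support ∧ ∀ u ∈ p.support, m.le u (m.lm p) := by
  have h : ∃ v, v ∈ p.support ∧ ∀ u ∈ p.support, m.le u v :=
    m.exists_le_of_nonempty (by simpa [Finset.nonempty_iff_ne_empty] using hp)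
  rw [lm, dif_pos h]
  exact h.choose_spec

theorem lc_ne_zero (m : AdmissibleOrder σ) {p : MvPolynomial σ K} (hp : p ≠ 0) :
    m.lc p ≠ 0 :=
  mem_support_iff.1 (m.lm_spec hp).1

/-- The monomials above `t + m.lm f` do not occur in the product of `f` by the monomial `t`. -/
theorem coeff_monomial_mul_eq_zero (m : AdmissibleOrder σ) {f : MvPolynomial σ K} (hf : f ≠ 0)
    {t u : σ →₀ ℕ} (c : K) (hu : m.lt (t + m.lm f) u) : coeff u (monomial t c * f) = 0 := by
  rw [coeff_monomial_mul']
  split_ifs with htu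
  · by_contra h
    have hle := m.add_right _ _ t
      ((m.lm_spec hf).2 _ (mem_support_iff.2 (right_ne_zero_of_mul h)))
    rw [tsub_add_cancel_of_le htu, add_comm] at hle
    exact hu.2 (m.antisymm _ _ hu.1 hle)
  · rfl

/-- A reduction step deletes a monomial and leaves the larger ones unchanged. -/
theorem Red.exists_coeff {m : AdmissibleOrder σ} {F : Set (MvPolynomial σ K)}
    {p q : MvPolynomial σ K} (h : m.Red F p q) :
    ∃ v, (∀ u, m.lt v u → coeff u q = coeff u p) ∧ coeff v q = 0 ∧ coeff v p ≠ 0 := by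
  obtain ⟨f, -, hf, t, hp, rfl⟩ := h
  refine ⟨t + m.lm f, fun u hu => ?_, ?_, hp⟩
  · rw [smul_mul_assoc, coeff_sub, coeff_smul, m.coeff_monomial_mul_eq_zero hf 1 hu, smul_zero,
      sub_zero]
  · rw [smul_mul_assoc, coeff_sub, coeff_smul, coeff_monomial_mul, one_mul, smul_eq_mul]
    change _ - _ / m.lc f * m.lc f = 0
    rw [div_mul_cancel₀ _ (m.lc_ne_zero hf), sub_self]

theorem wellFounded_red [Finite σ] (m : AdmissibleOrder σ) (F : Set (MvPolynomial σ K)) :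
    WellFounded fun q p : MvPolynomial σ K => m.Red F p q := by
  have hs : WellFounded fun a b : K => a = 0 ∧ b ≠ 0 :=
    ⟨fun _ => ⟨_, fun _ h => ⟨_, fun _ h' => (h'.2 h.1).elim⟩⟩⟩
  have : Std.Trichotomous (Function.swap m.lt) :=
    ⟨fun a b hab hba => by
      by_contra hne
      exact (m.total a b).elim (fun h => hba ⟨h, hne⟩) fun h => hab ⟨h, Ne.symm hne⟩⟩
  have hlex := Finsupp.Lex.wellFounded' (r := Function.swap m.lt) (fun _ h => h.2 rfl) hs
    m.wellFounded_lt
  exact (InvImage.wf (AddMonoidAlgebra.coeff : MvPolynomial σ K → _) hlex).mono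
    fun _ _ h => h.exists_coeff

end AdmissibleOrder

/-- The reduction relation modulo any set `F` is terminating: there is no infinite chain
of one-step reductions; equivalently, the converse of the reduction relation is
well-founded. -/
theorem red_terminating {σ K : Type*} [Fintype σ] [Field K] (m : AdmissibleOrder σ)
    (F : Set (MvPolynomial σ K)) :
    (¬ ∃ s : ℕ → MvPolynomial σ K, ∀ n, m.Red F (s n) (s (n + 1))) ∧
      WellFounded (fun q p : MvPolynomial σ K => m.Red F p q) := by
  exact ⟨fun ⟨s, hs⟩ =>
    (wellFounded_iff_isEmpty_descending_chain.1 (m.wellFounded_red F)).false ⟨s, hs⟩,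
    m.wellFounded_red F⟩
end

section
/- Let K be a field, σ a finite type of indeterminates, and fix an admissible monomial order ≼ on σ →₀ ℕ. Let G ⊆ MvPolynomial σ K be a Gröbner basis. Then for every polynomial p ∈ MvPolynomial σ K, p belongs to the ideal generated by G if and only if p →*_G 0, i.e., p reduces to 0 modulo G. -/
open MvPolynomial Relation

namespace AdmissibleOrder

variable {σ : Type*} {K : Type*} [Field K] (m : AdmissibleOrder σ)

theorem exists_forall_le {s : Finset (σ →₀ ℕ)} (hs : s.Nonempty) :
    ∃ v ∈ s, ∀ u ∈ s, m.le u v := by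
  induction hs using Finset.Nonempty.cons_induction with
  | singleton a => exact ⟨a, by simp, by simp [m.refl]⟩
  | cons a s _ _ ih =>
    obtain ⟨v, hv, hmax⟩ := ih
    simp only [Finset.mem_cons, forall_eq_or_imp, exists_eq_or_imp]
    rcases m.total a v with h | h
    · exact .inr ⟨v, hv, h, hmax⟩
    · exact .inl ⟨m.refl a, fun u hu => m.trans _ _ _ (hmax u hu) h⟩

theorem lc_ne_zero_s4 {f : MvPolynomial σ K} (hf : f ≠ 0) : m.lc f ≠ 0 := by
  have h := m.exists_forall_le (support_nonempty.mpr hf)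
  rw [lc, lm, dif_pos h]
  exact mem_support_iff.mp h.choose_spec.1

theorem coeff_add_lm (f : MvPolynomial σ K) (t : σ →₀ ℕ) :
    coeff (t + m.lm f) (monomial t (1 : K) * f) = m.lc f := by
  rw [coeff_monomial_mul, one_mul, lc]

variable {m} {G : Set (MvPolynomial σ K)}

/-- Reducing at the monomial `t + m.lm f`, with no assumption on its coefficient. -/
theorem reflTransGen_red_sub {f : MvPolynomial σ K} (hf : f ∈ G) (hf0 : f ≠ 0) (t : σ →₀ ℕ)
    (p : MvPolynomial σ K) :
    ReflTransGen (m.Red G) p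
      (p - (coeff (t + m.lm f) p / m.lc f) • (monomial t (1 : K)) * f) := by
  by_cases h : coeff (t + m.lm f) p = 0
  · simp only [h, zero_div, zero_smul, zero_mul, sub_zero]
    exact .refl
  · exact .single ⟨f, hf, hf0, t, h, rfl⟩

theorem join_add_monomial_mul {f : MvPolynomial σ K} (hf : f ∈ G) (t : σ →₀ ℕ) (c : K)
    (p : MvPolynomial σ K) :
    Join (ReflTransGen (m.Red G)) (p + monomial t c * f) p := by
  by_cases hf0 : f = 0
  · subst hf0
    exact ⟨p, by rw [mul_zero, add_zero], .refl⟩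
  refine ⟨_, ?_, reflTransGen_red_sub hf hf0 t p⟩
  convert reflTransGen_red_sub hf hf0 t (p + monomial t c * f) using 1
  have hc : monomial t c = c • monomial t (1 : K) := by rw [smul_monomial, smul_eq_mul, mul_one]
  simp only [hc, smul_mul_assoc, coeff_add, coeff_smul, coeff_add_lm, add_div, smul_eq_mul,
    mul_div_cancel_right₀ _ (m.lc_ne_zero_s4 hf0), add_smul, add_mul]
  abel

theorem IsGroebner.join_trans (hG : m.IsGroebner G) {a b c : MvPolynomial σ K}
    (hab : Join (ReflTransGen (m.Red G)) a b) (hbc : Join (ReflTransGen (m.Red G)) b c) :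
    Join (ReflTransGen (m.Red G)) a c := by
  obtain ⟨d, had, hbd⟩ := hab
  obtain ⟨e, hbe, hce⟩ := hbc
  obtain ⟨x, hdx, hex⟩ := hG b d e hbd hbe
  exact ⟨x, had.trans hdx, hce.trans hex⟩

theorem IsGroebner.join_add_mul (hG : m.IsGroebner G) {f : MvPolynomial σ K} (hf : f ∈ G)
    (a p : MvPolynomial σ K) : Join (ReflTransGen (m.Red G)) (p + a * f) p := by
  induction a using MvPolynomial.induction_on' generalizing p with
  | monomial t c => exact join_add_monomial_mul hf t c p
  | add a b iha ihb =>
    rw [add_mul, ← add_assoc]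
    exact hG.join_trans (ihb _) (iha _)

theorem IsGroebner.join_add_of_mem_span (hG : m.IsGroebner G) {x : MvPolynomial σ K}
    (hx : x ∈ Ideal.span G) (p : MvPolynomial σ K) :
    Join (ReflTransGen (m.Red G)) (p + x) p := by
  suffices h : ∀ a p, Join (ReflTransGen (m.Red G)) (p + a * x) p by simpa using h 1 p
  induction hx using Submodule.span_induction with
  | mem f hf => exact hG.join_add_mul hf
  | zero => exact fun a p => ⟨p, by rw [mul_zero, add_zero], .refl⟩
  | add x y _ _ ihx ihy =>
    intro a p
    rw [mul_add, ← add_assoc]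
    exact hG.join_trans (ihy _ _) (ihx _ _)
  | smul b x _ ih =>
    intro a p
    rw [smul_eq_mul, ← mul_assoc]
    exact ih _ _

theorem eq_zero_of_reflTransGen_red_zero {q : MvPolynomial σ K}
    (h : ReflTransGen (m.Red G) 0 q) : q = 0 := by
  induction h with
  | refl => rfl
  | tail _ hr ih =>
    subst ih
    obtain ⟨f, _, _, t, ht, _⟩ := hr
    exact absurd (coeff_zero _) ht

theorem Red.sub_mem_span {p q : MvPolynomial σ K} (h : m.Red G p q) : p - q ∈ Ideal.span G := by
  obtain ⟨f, hf, _, t, _, rfl⟩ := h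
  rw [sub_sub_cancel]
  exact Ideal.mul_mem_left _ _ (Ideal.subset_span hf)

theorem sub_mem_span_of_reflTransGen_red {p q : MvPolynomial σ K}
    (h : ReflTransGen (m.Red G) p q) : p - q ∈ Ideal.span G := by
  induction h with
  | refl => rw [sub_self]; exact zero_mem _
  | tail _ hr ih => simpa using add_mem ih hr.sub_mem_span

end AdmissibleOrder

/-- For a Gröbner basis `G`, membership in the ideal generated by `G` is equivalent to
reducibility to `0` modulo `G`. -/
theorem mem_span_iff_red_zero {σ K : Type*} [Fintype σ] [Field K] (m : AdmissibleOrder σ)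
    (G : Set (MvPolynomial σ K)) (hG : m.IsGroebner G) (p : MvPolynomial σ K) :
    p ∈ Ideal.span G ↔ Relation.ReflTransGen (m.Red G) p 0 := by
  constructor
  · intro hp
    obtain ⟨d, hpd, hd⟩ := hG.join_add_of_mem_span hp 0
    rwa [zero_add, AdmissibleOrder.eq_zero_of_reflTransGen_red_zero hd] at hpd
  · intro h
    simpa using AdmissibleOrder.sub_mem_span_of_reflTransGen_red h
end
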